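/- arXiv:2310.00090 — 5 statements merged into one kernel-verified Lean document; each statement's English description precedes it below -/
import Mathlib

section
/- Let r ≥ 3 and let 𝔽 = 𝔽_{2^r}. The number of tuples (a,b,c,d) ∈ 𝔽^4 such that the 4×4 Hadamard matrix Had(a,b,c,d) is MDS equals (2^r−1)(2^r−2)(2^r−4)(2^r−7). -/
open Matrix

/-- A square matrix is MDS if every square submatrix (selected via injective
row and column index maps) is nonsingular. -/
def IsMDS {F : Type*} [Field F] {ι : Type*} (M : Matrix ι ι F) : Prop :=
  ∀ (k : ℕ) (row : Fin k → ι) (col : Fin k → ι),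
    Function.Injective row → Function.Injective col →
    (M.submatrix row col).det ≠ 0

/-- The `4 × 4` finite-field Hadamard matrix with first row `a, b, c, d`. -/
def Had {F : Type*} (a b c d : F) : Matrix (Fin 4) (Fin 4) F :=
  !![a, b, c, d; b, a, d, c; c, d, a, b; d, c, b, a]

/-- The explicit nonvanishing conditions describing MDS Hadamard matrices in characteristic two. -/
def HadCond {F : Type*} [Field F] (a b c d : F) : Prop :=
  (a ≠ 0 ∧ b ≠ 0 ∧ b ≠ a) ∧ (c ≠ 0 ∧ c ≠ a ∧ c ≠ b) ∧
    (d ≠ 0 ∧ d ≠ a + b + c) ∧ (d ≠ a ∧ a * d ≠ b * c) ∧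
    (d ≠ b ∧ b * d ≠ a * c) ∧ (d ≠ c ∧ c * d ≠ a * b)

section Characterization

variable {F : Type*} [Field F]

theorem had_apply_ne_zero {a b c d : F} (ha : a ≠ 0) (hb : b ≠ 0) (hc : c ≠ 0) (hd : d ≠ 0)
    (i j : Fin 4) : Had a b c d i j ≠ 0 := by
  fin_cases i <;> fin_cases j <;> simpa [Had]

/-- If the square of `M` is a nonzero scalar matrix and `M` has no zero entry, then deleting one
row and one column of `M` leaves a nonsingular matrix. -/
theorem det_minor_ne_zero_of_mul_self {n : ℕ} {M : Matrix (Fin (n + 1)) (Fin (n + 1)) F}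
    {s : F} (hs : s ≠ 0) (hM : M * M = s • 1) (hne : ∀ i j, M i j ≠ 0)
    {row col : Fin n → Fin (n + 1)} (hrow : Function.Injective row)
    (hcol : Function.Injective col) : (M.submatrix row col).det ≠ 0 := by
  have key : ∀ f : Fin n → Fin (n + 1), Function.Injective f →
      ∃ p, p ∉ Set.range f ∧ ∀ i, i ≠ p → i ∈ Set.range f := by
    intro f hf
    have hcard : ((Finset.univ.image f)ᶜ).card = 1 := by
      rw [Finset.card_compl, Finset.card_image_of_injective _ hf]
      simp
    obtain ⟨p, hp⟩ := Finset.card_eq_one.mp hcard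
    have hiff : ∀ i, i ∉ Set.range f ↔ i = p := by
      intro i
      rw [← Finset.mem_singleton, ← hp]
      simp
    exact ⟨p, (hiff p).2 rfl, fun i hi => by_contra fun h => hi ((hiff i).1 h)⟩
  obtain ⟨p, -, hp⟩ := key row hrow
  obtain ⟨m, hm, -⟩ := key col hcol
  intro hdet
  obtain ⟨v, hv0, hv⟩ := Matrix.exists_mulVec_eq_zero_iff.mpr hdet
  let z : Fin (n + 1) → F := 0
  let w : Fin (n + 1) → F := Function.extend col v z
  have hwcol : ∀ j, w (col j) = v j := fun j => hcol.extend_apply v z j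
  have hwm : w m = 0 := Function.extend_apply' v z m hm
  have hwout : ∀ j, j ∉ Set.range col → w j = 0 := fun j hj => Function.extend_apply' v z j hj
  have hMw : ∀ i, i ≠ p → (M *ᵥ w) i = 0 := by
    intro i hi
    obtain ⟨k, rfl⟩ := hp i hi
    have hk := congrFun hv k
    simp only [Matrix.mulVec, dotProduct, Matrix.submatrix_apply, Pi.zero_apply] at hk ⊢
    rw [← hk]
    symm
    refine Finset.sum_of_injOn col hcol.injOn (by simp) ?_ (by simp [hwcol])
    intro j _ hj
    rw [hwout j (by simpa using hj), mul_zero]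
  have hsw : ∀ i, s * w i = M i p * (M *ᵥ w) p := by
    intro i
    have h := congrFun (congrArg (· *ᵥ w) hM) i
    simp only [← Matrix.mulVec_mulVec, Matrix.smul_mulVec, Matrix.one_mulVec, Pi.smul_apply,
      smul_eq_mul] at h
    rw [← h]
    exact Fintype.sum_eq_single p (f := fun j => M i j * (M *ᵥ w) j)
      (fun j hj => by rw [hMw j hj, mul_zero])
  have ht : (M *ᵥ w) p = 0 := by
    have h := hsw m
    rw [hwm, mul_zero] at h
    exact (mul_eq_zero.mp h.symm).resolve_left (hne m p)
  apply hv0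
  funext j
  have h := hsw (col j)
  rw [ht, mul_zero, hwcol] at h
  exact (mul_eq_zero.mp h).resolve_left hs

theorem det_submatrix_ne_zero_of_injective {n : ℕ} {M : Matrix (Fin n) (Fin n) F}
    {s : F} (hs : s ≠ 0) (hM : M * M = s • 1)
    {row col : Fin n → Fin n} (hrow : Function.Injective row)
    (hcol : Function.Injective col) : (M.submatrix row col).det ≠ 0 := by
  have hdet : M.det ≠ 0 := by
    intro h
    have h' := congrArg Matrix.det hM
    rw [Matrix.det_mul, h, Matrix.det_smul] at h'
    exact (pow_ne_zero _ hs) (by simpa [mul_zero] using h'.symm)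
  let e := Equiv.ofBijective row (Finite.injective_iff_bijective.mp hrow)
  let e' := Equiv.ofBijective col (Finite.injective_iff_bijective.mp hcol)
  have : M.submatrix row col = (M.submatrix e id).submatrix id e' := rfl
  rw [this, Matrix.det_permute', Matrix.det_permute]
  exact mul_ne_zero (Units.map (Int.castRingHom F).toMonoidHom _).ne_zero
    (mul_ne_zero (Units.map (Int.castRingHom F).toMonoidHom _).ne_zero hdet)

variable [CharP F 2]

theorem had_mul_self (a b c d : F) :
    Had a b c d * Had a b c d = (a + b + c + d) ^ 2 • (1 : Matrix (Fin 4) (Fin 4) F) := by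
  have h2 : (2 : F) = 0 := CharTwo.two_eq_zero
  ext i j
  fin_cases i <;> fin_cases j <;>
    simp [Had, Matrix.mul_apply, Fin.sum_univ_four] <;> grind

theorem HadCond.sum_ne_zero {a b c d : F} (h : HadCond a b c d) : a + b + c + d ≠ 0 := by
  obtain ⟨-, -, ⟨-, h⟩, -⟩ := h
  intro h0
  exact h (CharTwo.add_eq_zero.mp h0).symm

theorem HadCond.two_by_two {a b c d : F} (h : HadCond a b c d) (i i' j j' : Fin 4)
    (hi : i ≠ i') (hj : j ≠ j') :
    Had a b c d i j * Had a b c d i' j' ≠ Had a b c d i j' * Had a b c d i' j := by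
  obtain ⟨⟨ha, hb, hba⟩, ⟨hc, hca, hcb⟩, ⟨hd, -⟩, ⟨hda, had⟩, ⟨hdb, hbd⟩, ⟨hdc, hcd⟩⟩ := h
  have hsq : ∀ x y : F, x ≠ y → x * x ≠ y * y := fun x y hxy h =>
    hxy (CharTwo.sq_injective (by simpa [sq] using h))
  have h1 := hsq _ _ hba
  have h2 := hsq _ _ hca
  have h3 := hsq _ _ hcb
  have h4 := hsq _ _ hda
  have h5 := hsq _ _ hdb
  have h6 := hsq _ _ hdc
  fin_cases i <;> fin_cases i' <;> first | exact absurd rfl hi | skip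
  all_goals fin_cases j <;> fin_cases j' <;> first | exact absurd rfl hj | skip
  all_goals simp [Had] ; grind

theorem isMDS_had_iff (a b c d : F) : IsMDS (Had a b c d) ↔ HadCond a b c d := by
  constructor
  · intro h
    have e : ∀ i j, Had a b c d i j ≠ 0 := fun i j => by
      have := h 1 ![i] ![j] (Function.injective_of_subsingleton _)
        (Function.injective_of_subsingleton _)
      rwa [Matrix.det_fin_one] at this
    have m : ∀ i i' j j', i ≠ i' → j ≠ j' →
        Had a b c d i j * Had a b c d i' j' ≠ Had a b c d i j' * Had a b c d i' j := by
      intro i i' j j' hi hj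
      have := h 2 ![i, i'] ![j, j'] (by simpa [Function.Injective, Fin.forall_fin_two, eq_comm])
        (by simpa [Function.Injective, Fin.forall_fin_two, eq_comm])
      rw [Matrix.det_fin_two] at this
      exact sub_ne_zero.mp this
    have ha := e 0 0
    have hb := e 0 1
    have hc := e 0 2
    have hd := e 0 3
    have hab := m 0 1 0 1 (by decide) (by decide)
    have hac := m 0 2 0 2 (by decide) (by decide)
    have had := m 0 3 0 3 (by decide) (by decide)
    have hbc := m 0 3 1 2 (by decide) (by decide)
    have hbd := m 0 2 1 3 (by decide) (by decide)
    have hcd := m 0 1 2 3 (by decide) (by decide)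
    have h1 := m 0 1 0 2 (by decide) (by decide)
    have h2 := m 0 1 0 3 (by decide) (by decide)
    have h3 := m 0 2 0 3 (by decide) (by decide)
    have hs : d ≠ a + b + c := by
      intro hs
      have hdet := h 4 id id Function.injective_id Function.injective_id
      rw [Matrix.submatrix_id_id] at hdet
      have hdd := congrArg Matrix.det (had_mul_self a b c d)
      rw [hs, CharTwo.add_self_eq_zero, Matrix.det_mul, ← hs] at hdd
      simp [hdet] at hdd
    simp only [Had, Matrix.of_apply, Matrix.cons_val] at ha hb hc hd hab hac had hbc hbd hcd h1 h2 h3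
    exact ⟨⟨ha, hb, fun h => hab (by rw [h])⟩,
      ⟨hc, fun h => hac (by rw [h]), fun h => hbc (by rw [h])⟩, ⟨hd, hs⟩,
      ⟨fun h => had (by rw [h]), fun h => h1 (by linear_combination h)⟩,
      ⟨fun h => hbd (by rw [h]), fun h => h2 (by linear_combination -h)⟩,
      ⟨fun h => hcd (by rw [h]), fun h => h3 (by linear_combination -h)⟩⟩
  · intro h k row col hrow hcol
    have hs := pow_ne_zero 2 h.sum_ne_zero
    have he := had_apply_ne_zero h.1.1 h.1.2.1 h.2.1.1 h.2.2.1.1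
    have hk : k ≤ 4 := by simpa using Fintype.card_le_of_injective row hrow
    interval_cases k
    · simp
    · rw [Matrix.det_fin_one]
      exact he _ _
    · rw [Matrix.det_fin_two]
      exact sub_ne_zero.mpr
        (h.two_by_two _ _ _ _ (hrow.ne (by decide)) (hcol.ne (by decide)))
    · exact det_minor_ne_zero_of_mul_self hs (had_mul_self a b c d) he hrow hcol
    · exact det_submatrix_ne_zero_of_injective hs (had_mul_self a b c d) hrow hcol

end Characterization

section Counting

open Finset

theorem card_pair_add_ite {α : Type*} [DecidableEq α] (x y : α) :
    (({x, y} : Finset α).card : ℤ) = 2 - if x = y then 1 else 0 := by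
  split_ifs with h
  · simp [h]
  · simp [card_pair h]

theorem card_filter_prod_of_fiber {α β : Type*} [Fintype α] [Fintype β]
    (p : α × β → Prop) [DecidablePred p] (s : Finset α) (n : ℕ)
    (hs : ∀ a b, p (a, b) → a ∈ s)
    (hn : ∀ a ∈ s, #{b | p (a, b)} = n) : #{t | p t} = #s * n := by
  rw [card_filter, Fintype.sum_prod_type, ← sum_subset (subset_univ s)]
  · simp_rw [← card_filter]
    rw [sum_const_nat hn]
  · intro a _ ha
    exact sum_eq_zero fun b _ => if_neg fun h => ha (hs a b h)

variable {F : Type*} [Field F] [CharP F 2]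

theorem mul_div_ne_of_distinct {x y z s : F} (hx : x ≠ 0) (hy : y ≠ 0) (hz : z ≠ 0)
    (hyx : y ≠ x) (hzx : z ≠ x) (hzy : z ≠ y) (hs : s = x + y + z) :
    0 ≠ y * z / x ∧ s ≠ x ∧ s ≠ y * z / x ∧ y * z / x ≠ y ∧ y * z / x ≠ z := by
  refine ⟨(div_ne_zero (mul_ne_zero hy hz) hx).symm, fun h => ?_, fun h => ?_, fun h => ?_,
    fun h => ?_⟩
  · exact hzy (CharTwo.add_eq_zero.mp (by linear_combination h - hs))
  · rw [eq_div_iff hx, hs] at h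
    have h' : (x + y) * (x + z) = 0 := by
      linear_combination h + y * z * (CharTwo.two_eq_zero (R := F))
    rcases mul_eq_zero.mp h' with h' | h'
    · exact hyx (CharTwo.add_eq_zero.mp h').symm
    · exact hzx (CharTwo.add_eq_zero.mp h').symm
  · rw [div_eq_iff hx] at h
    exact hzx (mul_left_cancel₀ hy h)
  · rw [div_eq_iff hx, mul_comm] at h
    exact hyx (mul_left_cancel₀ hz h)

theorem mul_div_ne_mul_div {x y z : F} (hx : x ≠ 0) (hy : y ≠ 0) (hz : z ≠ 0) (hyx : y ≠ x) :
    y * z / x ≠ x * z / y := by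
  intro h
  rw [div_eq_div_iff hx hy] at h
  exact hyx (CharTwo.sq_injective (mul_left_cancel₀ hz (by linear_combination h)))

variable [Fintype F]

open Classical in
/-- The number of admissible last entries, given the first three. -/
theorem card_hadCond_last {a b c : F} (ha : a ≠ 0) (hb : b ≠ 0) (hba : b ≠ a)
    (hc : c ≠ 0) (hca : c ≠ a) (hcb : c ≠ b) :
    (#{d | HadCond a b c d} : ℤ) = Fintype.card F - 8 + ((if c = a + b then 1 else 0) +
      (if c = a ^ 2 / b then 1 else 0) + (if c = b ^ 2 / a then 1 else 0) +
      (if c ^ 2 = a * b then 1 else 0)) := by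
  have hE : ({d | HadCond a b c d} : Finset F) =
      (((({0, a + b + c} ∪ {a, b * c / a}) ∪ {b, a * c / b}) ∪ {c, a * b / c}) : Finset F)ᶜ := by
    ext d
    rw [mem_filter_univ]
    simp only [HadCond, mem_compl, mem_union, mem_insert, mem_singleton, eq_div_iff ha,
      eq_div_iff hb, eq_div_iff hc, mul_comm d]
    tauto
  obtain ⟨a0, as, ap, ab, ac⟩ := mul_div_ne_of_distinct ha hb hc hba hca hcb
    (s := a + b + c) (by ring)
  obtain ⟨b0, bs, bp, ba, bc⟩ := mul_div_ne_of_distinct hb ha hc hba.symm hcb hca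
    (s := a + b + c) (by ring)
  obtain ⟨c0, cs, cp, ca, cb⟩ := mul_div_ne_of_distinct hc ha hb hca.symm hcb.symm hba
    (s := a + b + c) (by ring)
  have pab := mul_div_ne_mul_div ha hb hc hba
  have pac := mul_div_ne_mul_div ha hc hb hca
  have pbc := mul_div_ne_mul_div hb hc ha hcb
  rw [mul_comm c b] at pac
  rw [mul_comm c a, mul_comm b a] at pbc
  have d1 : Disjoint ({0, a + b + c} : Finset F) {a, b * c / a} := by
    simp only [disjoint_insert_left, disjoint_singleton_left, mem_insert, mem_singleton, not_or]
    exact ⟨⟨ha.symm, a0⟩, as, ap⟩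
  have d2 : Disjoint ({0, a + b + c} ∪ {a, b * c / a} : Finset F) {b, a * c / b} := by
    simp only [disjoint_union_left, disjoint_insert_left, disjoint_singleton_left, mem_insert,
      mem_singleton, not_or]
    exact ⟨⟨⟨hb.symm, b0⟩, bs, bp⟩, ⟨hba.symm, ba.symm⟩, ab, pab⟩
  have d3 : Disjoint (({0, a + b + c} ∪ {a, b * c / a}) ∪ {b, a * c / b} : Finset F)
      {c, a * b / c} := by
    simp only [disjoint_union_left, disjoint_insert_left, disjoint_singleton_left, mem_insert,
      mem_singleton, not_or]
    exact ⟨⟨⟨⟨hc.symm, c0⟩, cs, cp⟩, ⟨hca.symm, ca.symm⟩, ac, pac⟩,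
      ⟨hcb.symm, cb.symm⟩, bc, pbc⟩
  rw [hE, card_compl, Nat.cast_sub (card_le_univ _), card_union_of_disjoint d3,
    card_union_of_disjoint d2, card_union_of_disjoint d1]
  push_cast
  simp only [card_pair_add_ite]
  have e1 : (0 = a + b + c) ↔ c = a + b := by
    rw [eq_comm, CharTwo.add_eq_zero, eq_comm]
  have e2 : (a = b * c / a) ↔ c = a ^ 2 / b := by
    rw [eq_div_iff ha, eq_div_iff hb]
    constructor <;> intro h <;> linear_combination -h
  have e3 : (b = a * c / b) ↔ c = b ^ 2 / a := by
    rw [eq_div_iff ha, eq_div_iff hb]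
    constructor <;> intro h <;> linear_combination -h
  have e4 : (c = a * b / c) ↔ c ^ 2 = a * b := by
    rw [eq_div_iff hc, sq]
  simp only [e1, e2, e3, e4]
  ring

open Classical in
theorem card_hadCond_last_two (hF : 8 ≤ Fintype.card F) {a b : F} (ha : a ≠ 0) (hb : b ≠ 0)
    (hba : b ≠ a) :
    #{t : F × F | HadCond a b t.1 t.2} = (Fintype.card F - 4) * (Fintype.card F - 7) := by
  have h2 : (2 : F) = 0 := CharTwo.two_eq_zero
  obtain ⟨r, hr⟩ : ∃ r, r ^ 2 = a * b := by
    obtain ⟨r, hr⟩ := (Finite.injective_iff_surjective.mp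
      (CharTwo.sq_injective (R := F))) (a * b)
    exact ⟨r, hr⟩
  have hsqrt : ∀ c, c ^ 2 = a * b ↔ c = r := fun c => by
    rw [← hr]
    exact CharTwo.sq_injective.eq_iff
  set s : Finset F := ({0, a, b} : Finset F)ᶜ with hs
  have hmem : ∀ c, c ∈ s ↔ c ≠ 0 ∧ c ≠ a ∧ c ≠ b := by simp [hs]
  have m1 : a + b ∈ s := by rw [hmem]; grind
  have m2 : a ^ 2 / b ∈ s := by
    rw [hmem, Ne, Ne, Ne, div_eq_iff hb, div_eq_iff hb, div_eq_iff hb]; grind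
  have m3 : b ^ 2 / a ∈ s := by
    rw [hmem, Ne, Ne, Ne, div_eq_iff ha, div_eq_iff ha, div_eq_iff ha]; grind
  have m4 : r ∈ s := by rw [hmem]; grind
  have hcard : (#s : ℤ) = Fintype.card F - 3 := by
    rw [hs, card_compl, card_eq_three.mpr ⟨0, a, b, ha.symm, hb.symm, hba.symm, rfl⟩]
    omega
  have hsum : #{t : F × F | HadCond a b t.1 t.2} = ∑ c ∈ s, #{d | HadCond a b c d} := by
    rw [card_filter, Fintype.sum_prod_type, ← sum_subset (subset_univ s)]
    · simp_rw [← card_filter]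
    · intro c _ hc
      exact sum_eq_zero fun d _ => if_neg fun h => hc ((hmem c).2 h.2.1)
  zify
  rw [hsum, Nat.cast_sub (by omega), Nat.cast_sub (by omega), Nat.cast_sum,
    sum_congr rfl fun c hc => card_hadCond_last ha hb hba ((hmem c).1 hc).1 ((hmem c).1 hc).2.1
      ((hmem c).1 hc).2.2]
  simp only [hsqrt, sum_add_distrib, sum_ite_eq', m1, m2, m3, m4, if_true, sum_const, nsmul_eq_mul,
    hcard]
  push_cast
  ring

open Classical in
theorem card_hadCond (hF : 8 ≤ Fintype.card F) :
    #{t : F × F × F × F | HadCond t.1 t.2.1 t.2.2.1 t.2.2.2} =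
      (Fintype.card F - 1) * (Fintype.card F - 2) * (Fintype.card F - 4) *
        (Fintype.card F - 7) := by
  have hcard : #({0}ᶜ : Finset F) = Fintype.card F - 1 := by simp [card_compl]
  rw [mul_assoc, mul_assoc, ← hcard]
  refine card_filter_prod_of_fiber _ _ _ (fun a t h => by simpa using h.1.1) fun a ha => ?_
  replace ha : a ≠ 0 := by simpa using ha
  have hcard' : #({0, a}ᶜ : Finset F) = Fintype.card F - 2 := by
    rw [card_compl, card_pair ha.symm]
  rw [← hcard']
  refine card_filter_prod_of_fiber (fun t : F × F × F => HadCond a t.1 t.2.1 t.2.2) _ _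
    (fun b t h => by simpa using h.1.2) fun b hb => ?_
  obtain ⟨hb0, hba⟩ : b ≠ 0 ∧ b ≠ a := by simpa using hb
  exact card_hadCond_last_two hF ha hb0 hba

end Counting

/-- The number of tuples `(a,b,c,d) ∈ 𝔽_{2^r}^4` (with `r ≥ 3`) whose `4 × 4`
Hadamard matrix is MDS equals `(2^r-1)(2^r-2)(2^r-4)(2^r-7)`. -/
theorem count_hadamard_mds (r : ℕ) (hr : 3 ≤ r) :
    Nat.card {t : GaloisField 2 r × GaloisField 2 r × GaloisField 2 r × GaloisField 2 r //
        IsMDS (Had t.1 t.2.1 t.2.2.1 t.2.2.2)} =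
      (2 ^ r - 1) * (2 ^ r - 2) * (2 ^ r - 4) * (2 ^ r - 7) := by
  classical
  let _ : Fintype (GaloisField 2 r) := Fintype.ofFinite _
  have hq : Fintype.card (GaloisField 2 r) = 2 ^ r := by
    rw [← Nat.card_eq_fintype_card]
    exact GaloisField.card 2 r (by omega)
  have h8 : 8 ≤ Fintype.card (GaloisField 2 r) := by
    rw [hq]
    exact Nat.pow_le_pow_right (n := 2) (by norm_num) hr
  have h := card_hadCond h8
  rw [hq] at h
  simp_rw [isMDS_had_iff]
  rw [Nat.card_eq_fintype_card, Fintype.card_subtype, ← h]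
end

section
/- Let r ≥ 2 and let 𝔽 = 𝔽_{2^r}. The number of 4×4 matrices over 𝔽 that are both involutory and MDS is at most 2^r·(2^r−1)³·(2^r−2)²·(2^r−3)·(2^r−4). -/
open Matrix

theorem IsMDS.apply_ne_zero {F : Type*} [Field F] {ι : Type*} {M : Matrix ι ι F}
    (hM : IsMDS M) (i j : ι) : M i j ≠ 0 := by
  simpa using hM 1 (fun _ => i) (fun _ => j) (Function.injective_of_subsingleton _)
    (Function.injective_of_subsingleton _)

theorem IsMDS.mul_sub_mul_ne_zero {F : Type*} [Field F] {ι : Type*} {M : Matrix ι ι F}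
    (hM : IsMDS M) {i i' j j' : ι} (hi : i ≠ i') (hj : j ≠ j') :
    M i j * M i' j' - M i j' * M i' j ≠ 0 := by
  have h := hM 2 ![i, i'] ![j, j'] (by simpa [Function.Injective, Fin.forall_fin_two, eq_comm])
    (by simpa [Function.Injective, Fin.forall_fin_two, eq_comm])
  rw [Matrix.det_fin_two] at h
  simpa using h

section FourByFour

variable {F : Type*} [Field F]

/-- The equation `M * M = 1`, entry by entry. -/
theorem involutory_apply {M : Matrix (Fin 4) (Fin 4) F} (h : M * M = 1) (i j : Fin 4) :
    M i 0 * M 0 j + M i 1 * M 1 j + M i 2 * M 2 j + M i 3 * M 3 j =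
      (1 : Matrix (Fin 4) (Fin 4) F) i j := by
  rw [← h, Matrix.mul_apply, Fin.sum_univ_four]

/-- An involutory `4 × 4` MDS matrix is determined by its first two rows. -/
theorem involutory_mds_eq_of_rows {M N : Matrix (Fin 4) (Fin 4) F} (hM : M * M = 1)
    (hN : N * N = 1) (hMDS : IsMDS M) (h0 : ∀ j, M 0 j = N 0 j) (h1 : ∀ j, M 1 j = N 1 j) :
    M = N := by
  have hd := hMDS.mul_sub_mul_ne_zero (i := 0) (i' := 1) (j := 2) (j' := 3) (by decide) (by decide)
  have h2 : ∀ j, M 2 j = N 2 j := fun j => by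
    have e0 := involutory_apply hM 0 j
    have e1 := involutory_apply hM 1 j
    have f0 := involutory_apply hN 0 j
    have f1 := involutory_apply hN 1 j
    simp only [← h0, ← h1] at f0 f1
    refine mul_left_cancel₀ hd ?_
    linear_combination M 1 3 * (e0 - f0) - M 0 3 * (e1 - f1)
  have h3 : ∀ j, M 3 j = N 3 j := fun j => by
    have e0 := involutory_apply hM 0 j
    have f0 := involutory_apply hN 0 j
    simp only [← h0, ← h1, ← h2] at f0
    refine mul_left_cancel₀ (hMDS.apply_ne_zero 0 3) ?_
    linear_combination e0 - f0
  ext i j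
  fin_cases i
  exacts [h0 j, h1 j, h2 j, h3 j]

/-- The second row of `M`, made invariant under diagonal conjugation, with its first entry
divided by `M 0 0`. -/
def normalizedRow (M : Matrix (Fin 4) (Fin 4) F) : Fin 4 → F :=
  ![M 0 1 * M 1 0 / M 0 0, M 1 1, M 0 1 * M 1 2 / M 0 2, M 0 1 * M 1 3 / M 0 3]

theorem normalizedRow_eq (M : Matrix (Fin 4) (Fin 4) F) (h : M 0 1 ≠ 0) (j : Fin 4) :
    normalizedRow M j = M 0 1 * M 1 j / M 0 j := by
  fin_cases j <;> simp [normalizedRow, h]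

theorem normalizedRow_ne_zero {M : Matrix (Fin 4) (Fin 4) F} (hM : IsMDS M) (j : Fin 4) :
    normalizedRow M j ≠ 0 := by
  rw [normalizedRow_eq M (hM.apply_ne_zero 0 1)]
  exact div_ne_zero (mul_ne_zero (hM.apply_ne_zero 0 1) (hM.apply_ne_zero 1 j))
    (hM.apply_ne_zero 0 j)

theorem normalizedRow_injective {M : Matrix (Fin 4) (Fin 4) F} (hM : IsMDS M) :
    Function.Injective (normalizedRow M) := by
  intro j k h
  by_contra hjk
  rw [normalizedRow_eq M (hM.apply_ne_zero 0 1), normalizedRow_eq M (hM.apply_ne_zero 0 1),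
    div_eq_div_iff (hM.apply_ne_zero 0 j) (hM.apply_ne_zero 0 k)] at h
  refine hM.mul_sub_mul_ne_zero (i := 0) (i' := 1) (by decide) hjk
    (mul_left_cancel₀ (hM.apply_ne_zero 0 1) ?_)
  linear_combination -h

/-- The scalar which recovers `M 0 0` from `normalizedRow M`; it equals `1` only if
`M 2 3 = 0`. -/
def cornerRatio (M : Matrix (Fin 4) (Fin 4) F) : F :=
  M 0 0 * (normalizedRow M 3 - normalizedRow M 0) /
    (normalizedRow M 3 * (normalizedRow M 1 - normalizedRow M 3))

theorem cornerRatio_ne_zero {M : Matrix (Fin 4) (Fin 4) F} (hM : IsMDS M) :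
    cornerRatio M ≠ 0 :=
  div_ne_zero
    (mul_ne_zero (hM.apply_ne_zero 0 0)
      (sub_ne_zero.2 ((normalizedRow_injective hM).ne (by decide))))
    (mul_ne_zero (normalizedRow_ne_zero hM 3)
      (sub_ne_zero.2 ((normalizedRow_injective hM).ne (by decide))))

theorem cornerRatio_ne_one {M : Matrix (Fin 4) (Fin 4) F} (h : M * M = 1) (hM : IsMDS M) :
    cornerRatio M ≠ 1 := by
  intro h1
  have hb : normalizedRow M 3 * (normalizedRow M 1 - normalizedRow M 3) ≠ 0 :=
    mul_ne_zero (normalizedRow_ne_zero hM 3)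
      (sub_ne_zero.2 ((normalizedRow_injective hM).ne (by decide)))
  rw [cornerRatio, div_eq_one_iff_eq hb] at h1
  have a00 := hM.apply_ne_zero 0 0
  have a01 := hM.apply_ne_zero 0 1
  have a03 := hM.apply_ne_zero 0 3
  have e0 := involutory_apply h 0 3
  have e1 := involutory_apply h 1 3
  simp only [ne_eq, Fin.reduceEq, not_false_eq_true, Matrix.one_apply_ne] at e0 e1
  have hd := hM.mul_sub_mul_ne_zero (i := 0) (i' := 1) (j := 2) (j' := 3) (by decide) (by decide)
  refine mul_ne_zero hd (hM.apply_ne_zero 2 3) ?_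
  simp only [normalizedRow_eq M a01] at h1
  field_simp at h1
  refine mul_left_cancel₀ a01 ?_
  linear_combination M 0 1 * (M 1 3 * e0 - M 0 3 * e1) - M 0 1 * h1

theorem involutory_mds_eq_of_invariants {M N : Matrix (Fin 4) (Fin 4) F} (hM : M * M = 1)
    (hN : N * N = 1) (hMDS : IsMDS M) (hNDS : IsMDS N)
    (h0 : ∀ j : Fin 3, M 0 j.succ = N 0 j.succ) (hr : normalizedRow M = normalizedRow N)
    (hc : cornerRatio M = cornerRatio N) : M = N := by
  have h00 : M 0 0 = N 0 0 := by
    have hb : normalizedRow N 3 * (normalizedRow N 1 - normalizedRow N 3) ≠ 0 :=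
      mul_ne_zero (normalizedRow_ne_zero hNDS 3)
        (sub_ne_zero.2 ((normalizedRow_injective hNDS).ne (by decide)))
    rw [cornerRatio, cornerRatio, hr, div_left_inj' hb] at hc
    exact mul_right_cancel₀
      (sub_ne_zero.2 ((normalizedRow_injective hNDS).ne (by decide))) hc
  have h0' : ∀ j, M 0 j = N 0 j := Fin.cases h00 h0
  refine involutory_mds_eq_of_rows hM hN hMDS h0' fun j => ?_
  have h := congrFun hr j
  rw [normalizedRow_eq M (hMDS.apply_ne_zero 0 1), normalizedRow_eq N (hNDS.apply_ne_zero 0 1),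
    h0', h0', div_left_inj' (hNDS.apply_ne_zero 0 j)] at h
  exact mul_left_cancel₀ (hNDS.apply_ne_zero 0 1) h

theorem card_involutory_mds_le [Finite F] :
    Nat.card {M : Matrix (Fin 4) (Fin 4) F // M * M = 1 ∧ IsMDS M} ≤
      (Nat.card F - 1) ^ 3 * ((Nat.card F - 1).descFactorial 4 * (Nat.card F - 2)) := by
  classical
  have := Fintype.ofFinite F
  let f : {M : Matrix (Fin 4) (Fin 4) F // M * M = 1 ∧ IsMDS M} →
      (Fin 3 → Fˣ) × (Fin 4 ↪ Fˣ) × {t : Fˣ // t ≠ 1} := fun M =>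
    (fun j => Units.mk0 (M.1 0 j.succ) (M.2.2.apply_ne_zero _ _),
      ⟨fun j => Units.mk0 (normalizedRow M.1 j) (normalizedRow_ne_zero M.2.2 j),
        fun _ _ h => normalizedRow_injective M.2.2 (Units.mk0_inj _ _ |>.1 h)⟩,
      ⟨Units.mk0 (cornerRatio M.1) (cornerRatio_ne_zero M.2.2), fun h =>
        cornerRatio_ne_one M.2.1 M.2.2 (congrArg Units.val h)⟩)
  have hf : Function.Injective f := by
    intro M N h
    have h1 := congrArg Prod.fst h
    have h2 := congrArg (fun x => x.2.1) h
    have h3 := congrArg (fun x => (x.2.2 : Fˣ)) h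
    exact Subtype.ext (involutory_mds_eq_of_invariants M.2.1 N.2.1 M.2.2 N.2.2
      (fun j => congrArg Units.val (congrFun h1 j))
      (funext fun j => congrArg Units.val (DFunLike.congr_fun h2 j))
      (congrArg Units.val h3))
  refine (Nat.card_le_card_of_injective f hf).trans_eq ?_
  simp [Fintype.card_units, Fintype.card_embedding_eq, Fintype.card_subtype_compl, Nat.sub_sub]

end FourByFour

/-- The number of `4 × 4` involutory MDS matrices over `𝔽_{2^r}` (with `r ≥ 2`)
is at most `2^r(2^r-1)³(2^r-2)²(2^r-3)(2^r-4)`. -/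
theorem count_four_by_four_involutory_mds_le (r : ℕ) (hr : 2 ≤ r) :
    Nat.card {M : Matrix (Fin 4) (Fin 4) (GaloisField 2 r) //
        M * M = 1 ∧ IsMDS M} ≤
      2 ^ r * (2 ^ r - 1) ^ 3 * (2 ^ r - 2) ^ 2 * (2 ^ r - 3) * (2 ^ r - 4) := by
  have hq : Nat.card (GaloisField 2 r) = 2 ^ r := GaloisField.card 2 r (by omega)
  have : Finite (GaloisField 2 r) := Nat.finite_of_card_ne_zero (by simp [hq])
  refine card_involutory_mds_le.trans ?_
  rw [hq]
  generalize 2 ^ r = q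
  calc (q - 1) ^ 3 * ((q - 1).descFactorial 4 * (q - 2))
      = (q - 1) * (q - 1) ^ 3 * (q - 2) ^ 2 * (q - 3) * (q - 4) := by
        simp only [Nat.descFactorial_succ, Nat.descFactorial_zero, Nat.sub_sub]
        ring
    _ ≤ q * (q - 1) ^ 3 * (q - 2) ^ 2 * (q - 3) * (q - 4) := by
        gcongr
        exact Nat.sub_le q 1
end

section
/- Let r ≥ 1, 𝔽 = 𝔽_{2^r}, and let a1, a2, a3, a4 ∈ 𝔽 be such that exactly one of a1, a2, a3, a4 equals 0 and a1 + a2 + a3 + a4 ≠ 0. Then the 4×4 Hadamard matrix Had(a1, a2, a3, a4) is an NMDS matrix over 𝔽. -/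
open Matrix

/-- A square matrix of order `n` is Near-MDS if it is not MDS and, for every
`1 ≤ g ≤ n - 1`, every `g × (g+1)` and `(g+1) × g` submatrix contains a
nonsingular `g × g` submatrix. -/
def IsNMDS {F : Type*} [Field F] {ι : Type*} [Fintype ι] (M : Matrix ι ι F) : Prop :=
  ¬ IsMDS M ∧
  ∀ g : ℕ, 1 ≤ g → g ≤ Fintype.card ι - 1 →
    (∀ (row : Fin g → ι) (col : Fin (g + 1) → ι),
        Function.Injective row → Function.Injective col →
        ∃ s : Fin g → Fin (g + 1), Function.Injective s ∧
          (M.submatrix row (col ∘ s)).det ≠ 0) ∧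
    (∀ (row : Fin (g + 1) → ι) (col : Fin g → ι),
        Function.Injective row → Function.Injective col →
        ∃ s : Fin g → Fin (g + 1), Function.Injective s ∧
          (M.submatrix (row ∘ s) col).det ≠ 0)

/-- Exactly one of the four elements equals zero. -/
def ExactlyOneZero {F : Type*} [Zero F] (a b c d : F) : Prop :=
  (a = 0 ∧ b ≠ 0 ∧ c ≠ 0 ∧ d ≠ 0) ∨ (a ≠ 0 ∧ b = 0 ∧ c ≠ 0 ∧ d ≠ 0) ∨
  (a ≠ 0 ∧ b ≠ 0 ∧ c = 0 ∧ d ≠ 0) ∨ (a ≠ 0 ∧ b ≠ 0 ∧ c ≠ 0 ∧ d = 0)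

section

variable {F : Type*} [Field F]

theorem not_isMDS_of_apply_eq_zero {ι : Type*} {M : Matrix ι ι F} {i j : ι}
    (h : M i j = 0) : ¬ IsMDS M := fun hM =>
  hM 1 (fun _ => i) (fun _ => j) (Function.injective_of_subsingleton _)
    (Function.injective_of_subsingleton _) (by simp [h])

/-- Any `n` rows of a nonsingular matrix of order `n + 1` contain a nonsingular minor. -/
theorem exists_minor_ne_zero_of_det_ne_zero {n : ℕ}
    {M : Matrix (Fin (n + 1)) (Fin (n + 1)) F} (hM : M.det ≠ 0)
    {row : Fin n → Fin (n + 1)} {col : Fin (n + 1) → Fin (n + 1)}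
    (hrow : Function.Injective row) (hcol : Function.Injective col) :
    ∃ s : Fin n → Fin (n + 1), Function.Injective s ∧
      (M.submatrix row (col ∘ s)).det ≠ 0 := by
  obtain ⟨x, hx⟩ : ∃ x, x ∉ Set.range row := by
    by_contra! h
    simpa using Fintype.card_le_of_surjective row h
  have hcons : Function.Injective (Fin.cons x row : Fin (n + 1) → Fin (n + 1)) :=
    Fin.cons_injective_iff.2 ⟨hx, hrow⟩
  let e₁ := Equiv.ofBijective _ (Finite.injective_iff_bijective.1 hcons)
  let e₂ := Equiv.ofBijective col (Finite.injective_iff_bijective.1 hcol)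
  have hdet : (M.submatrix e₁ e₂).det ≠ 0 := by
    rw [← isUnit_iff_ne_zero, ← isUnit_iff_isUnit_det, isUnit_submatrix_equiv,
      isUnit_iff_isUnit_det, isUnit_iff_ne_zero]
    exact hM
  rw [det_succ_row_zero] at hdet
  obtain ⟨j, -, hj⟩ := Finset.exists_ne_zero_of_sum_ne_zero hdet
  exact ⟨j.succAbove, Fin.succAbove_right_injective, right_ne_zero_of_mul hj⟩

/-- If a nonsingular matrix of order `4` has its zeros exactly on a permutation pattern,
then every `g × (g + 1)` submatrix contains a nonsingular `g × g` submatrix. -/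
theorem exists_minor_ne_zero {M : Matrix (Fin 4) (Fin 4) F} (hdet : M.det ≠ 0)
    {σ : Fin 4 → Fin 4} (hσ : Function.Injective σ) (hM : ∀ i j, M i j = 0 ↔ j = σ i)
    {g : ℕ} (hg : 1 ≤ g) (hg' : g ≤ Fintype.card (Fin 4) - 1)
    (row : Fin g → Fin 4) (col : Fin (g + 1) → Fin 4)
    (hrow : Function.Injective row) (hcol : Function.Injective col) :
    ∃ s : Fin g → Fin (g + 1), Function.Injective s ∧
      (M.submatrix row (col ∘ s)).det ≠ 0 := by
  rw [Fintype.card_fin] at hg'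
  interval_cases g
  · obtain ⟨j, hj⟩ : ∃ j, col j ≠ σ (row 0) := by
      by_contra! h
      exact absurd (hcol ((h 0).trans (h 1).symm)) (by decide)
    refine ⟨fun _ => j, Function.injective_of_subsingleton _, ?_⟩
    simpa [hM] using hj
  · have hne : σ (row 0) ≠ σ (row 1) := fun h => absurd (hrow (hσ h)) (by decide)
    obtain ⟨j, hj⟩ : ∃ j, col j = σ (row 0) ∨ col j = σ (row 1) := by
      have h01 := hcol.ne (show (0 : Fin 3) ≠ 1 by decide)
      have h02 := hcol.ne (show (0 : Fin 3) ≠ 2 by decide)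
      have h12 := hcol.ne (show (1 : Fin 3) ≠ 2 by decide)
      by_contra! h
      have h0 := h 0
      have h1 := h 1
      have h2 := h 2
      omega
    obtain ⟨k, hk⟩ := exists_ne j
    have hkj := hcol.ne hk
    refine ⟨![j, k], ?_, ?_⟩
    · intro a b
      fin_cases a <;> fin_cases b <;> simp [hk, hk.symm]
    · have h0 := hM (row 0)
      have h1 := hM (row 1)
      rw [det_fin_two]
      rcases hj with hj | hj
      · have ha := (h0 _).2 hj
        have hb := mt (h0 (col k)).1 (hj ▸ hkj)
        have hc := mt (h1 (col j)).1 (hj ▸ hne)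
        simp [ha, hb, hc]
      · have ha := (h1 _).2 hj
        have hb := mt (h1 (col k)).1 (hj ▸ hkj)
        have hc := mt (h0 (col j)).1 (hj ▸ hne.symm)
        simp [ha, hb, hc]
  · exact exists_minor_ne_zero_of_det_ne_zero hdet hrow hcol

theorem transpose_had {α : Type*} (a b c d : α) : (Had a b c d)ᵀ = Had a b c d := by
  ext i j
  fin_cases i <;> fin_cases j <;> rfl

theorem det_had [CharP F 2] (a b c d : F) : (Had a b c d).det = (a + b + c + d) ^ 4 := by
  have h2 : (2 : F) = 0 := CharTwo.two_eq_zero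
  simp [Had, det_succ_row_zero, Fin.sum_univ_succ, Fin.succAbove]
  grind

theorem exists_zero_pattern_had {a b c d : F} (h : ExactlyOneZero a b c d) :
    ∃ σ : Fin 4 → Fin 4, Function.Injective σ ∧ ∀ i j, Had a b c d i j = 0 ↔ j = σ i := by
  rcases h with h | h | h | h <;> obtain ⟨ha, hb, hc, hd⟩ := h
  · refine ⟨![0, 1, 2, 3], by decide, fun i j => ?_⟩
    fin_cases i <;> fin_cases j <;> simp [Had, ha, hb, hc, hd]
  · refine ⟨![1, 0, 3, 2], by decide, fun i j => ?_⟩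
    fin_cases i <;> fin_cases j <;> simp [Had, ha, hb, hc, hd]
  · refine ⟨![2, 3, 0, 1], by decide, fun i j => ?_⟩
    fin_cases i <;> fin_cases j <;> simp [Had, ha, hb, hc, hd]
  · refine ⟨![3, 2, 1, 0], by decide, fun i j => ?_⟩
    fin_cases i <;> fin_cases j <;> simp [Had, ha, hb, hc, hd]

end

/-- If exactly one of `a₁, a₂, a₃, a₄ ∈ 𝔽_{2^r}` is zero and
`a₁ + a₂ + a₃ + a₄ ≠ 0`, then `Had(a₁, a₂, a₃, a₄)` is NMDS. -/
theorem hadamard_one_zero_nmds (r : ℕ) (hr : 1 ≤ r)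
    (a1 a2 a3 a4 : GaloisField 2 r)
    (hzero : ExactlyOneZero a1 a2 a3 a4)
    (hsum : a1 + a2 + a3 + a4 ≠ 0) :
    IsNMDS (Had a1 a2 a3 a4) := by
  obtain ⟨σ, hσ, hM⟩ := exists_zero_pattern_had hzero
  have hdet : (Had a1 a2 a3 a4).det ≠ 0 := by
    rw [det_had]
    exact pow_ne_zero 4 hsum
  refine ⟨not_isMDS_of_apply_eq_zero ((hM 0 (σ 0)).2 rfl), fun g hg hg' => ?_⟩
  have key := exists_minor_ne_zero hdet hσ hM hg hg'
  refine ⟨key, fun row col hrow hcol => ?_⟩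
  obtain ⟨s, hs, h⟩ := key col row hcol hrow
  refine ⟨s, hs, ?_⟩
  rwa [← det_transpose, transpose_submatrix, transpose_had]
end

section
/- Let r ≥ 1 and let 𝔽 = 𝔽_{2^r}. The number of tuples (a1, a2, a3, a4) ∈ 𝔽^4 such that exactly one of a1, a2, a3, a4 equals 0 and the 4×4 Hadamard matrix Had(a1, a2, a3, a4) is NMDS equals 4·(2^r−1)·(2^{2r} − 3·2^r + 3). -/
open Matrix

/-- A matrix with linearly independent rows has a nonsingular maximal square submatrix. -/
lemma exists_det_submatrix_ne_zero_of_linearIndependent_row {F : Type*} [Field F] {g m : ℕ}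
    (N : Matrix (Fin g) (Fin m) F) (hN : LinearIndependent F N.row) :
    ∃ s : Fin g → Fin m, Function.Injective s ∧ (N.submatrix id s).det ≠ 0 := by
  obtain ⟨κ, a, ha, hspan, hli⟩ := exists_linearIndependent' F N.col
  have : Fintype κ := Fintype.ofInjective a ha
  have hcard : Fintype.card κ = g := by
    rw [linearIndependent_iff_card_eq_finrank_span.mp hli, Set.finrank, hspan,
      ← rank_eq_finrank_span_cols, hN.rank_matrix, Fintype.card_fin]
  let e : Fin g ≃ κ := (Fintype.equivFinOfCardEq hcard).symm
  refine ⟨a ∘ e, ha.comp e.injective, ?_⟩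
  have hcols : LinearIndependent F (N.submatrix id (a ∘ e)).col := hli.comp e e.injective
  exact ((isUnit_iff_isUnit_det _).mp (linearIndependent_cols_iff_isUnit.mp hcols)).ne_zero

lemma Had_transpose {F : Type*} (a b c d : F) : (Had a b c d)ᵀ = Had a b c d := by
  ext i j
  fin_cases i <;> fin_cases j <;> rfl

section Had

variable {F : Type*} [Field F] {a b c d : F}

lemma Had_mul_self [CharP F 2] (a b c d : F) :
    Had a b c d * Had a b c d = (a + b + c + d) ^ 2 • (1 : Matrix (Fin 4) (Fin 4) F) := by
  have h2 : (2 : F) = 0 := CharTwo.two_eq_zero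
  ext i j
  fin_cases i <;> fin_cases j <;>
    simp [Had, Matrix.mul_apply, Fin.sum_univ_four] <;> grind

/-- If exactly one parameter vanishes, the zeros of `Had a b c d` form a permutation pattern. -/
lemma ExactlyOneZero.exists_zero_pattern (h : ExactlyOneZero a b c d) :
    ∃ z : Fin 4 → Fin 4, Function.Injective z ∧ ∀ i j, Had a b c d i j = 0 ↔ j = z i := by
  rcases h with ⟨h1, h2, h3, h4⟩ | ⟨h1, h2, h3, h4⟩ | ⟨h1, h2, h3, h4⟩ | ⟨h1, h2, h3, h4⟩
  · refine ⟨![0, 1, 2, 3], by decide, fun i j ↦ ?_⟩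
    fin_cases i <;> fin_cases j <;> simp [Had, *]
  · refine ⟨![1, 0, 3, 2], by decide, fun i j ↦ ?_⟩
    fin_cases i <;> fin_cases j <;> simp [Had, *]
  · refine ⟨![2, 3, 0, 1], by decide, fun i j ↦ ?_⟩
    fin_cases i <;> fin_cases j <;> simp [Had, *]
  · refine ⟨![3, 2, 1, 0], by decide, fun i j ↦ ?_⟩
    fin_cases i <;> fin_cases j <;> simp [Had, *]

lemma det_submatrix_Had_eq_zero [CharP F 2] (h : a + b + c + d = 0) (row col : Fin 3 → Fin 4) :
    ((Had a b c d).submatrix row col).det = 0 := by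
  by_contra hdet
  have hmul : Had a b c d * Had a b c d = 0 := by simp [Had_mul_self, h]
  have hrank := rank_add_rank_le_card_of_mul_eq_zero hmul
  have hsub := rank_submatrix_le (Had a b c d) row col
  rw [rank_of_isUnit _ ((isUnit_iff_isUnit_det _).mpr (isUnit_iff_ne_zero.mpr hdet))] at hsub
  simp only [Fintype.card_fin] at hrank hsub
  omega

/-- A square matrix whose zeros form a permutation pattern has a nonsingular submatrix of full
size in any one or two of its rows. -/
lemma exists_det_submatrix_ne_zero_of_zero_pattern_two {M : Matrix (Fin 4) (Fin 4) F}
    {z : Fin 4 → Fin 4} (hz : Function.Injective z) (hM : ∀ i j, M i j = 0 ↔ j = z i)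
    (row : Fin 2 → Fin 4) (col : Fin 3 → Fin 4) (hrow : Function.Injective row)
    (hcol : Function.Injective col) :
    ∃ s : Fin 2 → Fin 3, Function.Injective s ∧ (M.submatrix row (col ∘ s)).det ≠ 0 := by
  have hne : z (row 0) ≠ z (row 1) := hz.ne (hrow.ne (by decide))
  have hpigeon : ∃ x, col x = z (row 0) ∨ col x = z (row 1) := by
    by_contra! hx
    have h01 := hcol.ne (show (0 : Fin 3) ≠ 1 by decide)
    have h02 := hcol.ne (show (0 : Fin 3) ≠ 2 by decide)
    have h12 := hcol.ne (show (1 : Fin 3) ≠ 2 by decide)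
    have := hx 0
    have := hx 1
    have := hx 2
    omega
  obtain ⟨x, hx⟩ := hpigeon
  have hy : col (x + 1) ≠ col x := hcol.ne (by simp)
  refine ⟨![x, x + 1], ?_, ?_⟩
  · clear hx hy
    revert x
    decide
  · rw [det_fin_two]
    simp only [submatrix_apply, Function.comp_apply, cons_val_zero, cons_val_one]
    rcases hx with hx | hx
    · rw [(hM (row 0) (col x)).mpr hx, zero_mul, zero_sub, neg_ne_zero]
      exact mul_ne_zero (by grind) (by grind)
    · rw [(hM (row 1) (col x)).mpr hx, mul_zero, sub_zero]
      exact mul_ne_zero (by grind) (by grind)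

lemma exists_det_submatrix_Had_ne_zero [CharP F 2] (h : ExactlyOneZero a b c d)
    (hs : a + b + c + d ≠ 0) {g : ℕ} (hg1 : 1 ≤ g) (hg3 : g ≤ 3)
    (row : Fin g → Fin 4) (col : Fin (g + 1) → Fin 4)
    (hrow : Function.Injective row) (hcol : Function.Injective col) :
    ∃ s : Fin g → Fin (g + 1), Function.Injective s ∧
      ((Had a b c d).submatrix row (col ∘ s)).det ≠ 0 := by
  obtain ⟨z, hz, hM⟩ := h.exists_zero_pattern
  obtain rfl | rfl | rfl : g = 1 ∨ g = 2 ∨ g = 3 := by omega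
  · have hne : col 0 ≠ col 1 := hcol.ne (by decide)
    obtain ⟨x, hx⟩ : ∃ x, col x ≠ z (row 0) := by
      by_contra! hx
      exact hne ((hx 0).trans (hx 1).symm)
    exact ⟨fun _ ↦ x, Function.injective_of_subsingleton _, by simpa [hM] using hx⟩
  · exact exists_det_submatrix_ne_zero_of_zero_pattern_two hz hM row col hrow hcol
  · let e : Fin 4 ≃ Fin 4 := Equiv.ofBijective col (Finite.injective_iff_bijective.mp hcol)
    have hunit : IsUnit (Had a b c d) := by
      refine IsUnit.of_mul_eq_one (((a + b + c + d) ^ 2)⁻¹ • Had a b c d) ?_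
      rw [mul_smul_comm, Had_mul_self, smul_smul, inv_mul_cancel₀ (pow_ne_zero 2 hs), one_smul]
    have hunit' : IsUnit ((Had a b c d).submatrix id e) :=
      (isUnit_submatrix_equiv (Equiv.refl _) e).mpr hunit
    have hli := (linearIndependent_rows_iff_isUnit.mpr hunit').comp row hrow
    exact exists_det_submatrix_ne_zero_of_linearIndependent_row
      ((Had a b c d).submatrix row col) hli

lemma ExactlyOneZero.isNMDS_Had_iff [CharP F 2] (h : ExactlyOneZero a b c d) :
    IsNMDS (Had a b c d) ↔ a + b + c + d ≠ 0 := by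
  constructor
  · rintro ⟨-, hN⟩ hs
    obtain ⟨s, -, hdet⟩ := (hN 3 (by norm_num) (by simp)).1 Fin.castSucc id
      (Fin.castSucc_injective 3) Function.injective_id
    exact hdet (det_submatrix_Had_eq_zero hs _ _)
  · intro hs
    refine ⟨fun hMDS ↦ ?_, fun g hg1 hg3 ↦ ?_⟩
    · obtain ⟨z, -, hM⟩ := h.exists_zero_pattern
      refine hMDS 1 (fun _ ↦ 0) (fun _ ↦ z 0) (Function.injective_of_subsingleton _)
        (Function.injective_of_subsingleton _) ?_
      simp [hM]
    · have hg3' : g ≤ 3 := by simpa using hg3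
      refine ⟨exists_det_submatrix_Had_ne_zero h hs hg1 hg3', fun row col hrow hcol ↦ ?_⟩
      obtain ⟨s, hs', hdet⟩ := exists_det_submatrix_Had_ne_zero h hs hg1 hg3' col row hcol hrow
      refine ⟨s, hs', ?_⟩
      rwa [← det_transpose, transpose_submatrix, Had_transpose]

end Had

section Counting

variable {F : Type*} [Field F] [CharP F 2] [Fintype F] [DecidableEq F]

lemma sum_indicator_nonzero_sum_ne_zero :
    ∑ x : F, ∑ y : F, ∑ z : F,
      (if x ≠ 0 ∧ y ≠ 0 ∧ z ≠ 0 ∧ x + y + z ≠ 0 then (1 : ℤ) else 0) =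
    (Fintype.card F - 1) * (Fintype.card F ^ 2 - 3 * Fintype.card F + 3) := by
  have hz (x y : F) : ∑ z : F,
      (if x ≠ 0 ∧ y ≠ 0 ∧ z ≠ 0 ∧ x + y + z ≠ 0 then (1 : ℤ) else 0) =
      if x = 0 then 0 else if y = 0 then 0 else
        ((Fintype.card F : ℤ) - 2 + if x = y then 1 else 0) := by
    by_cases hx : x = 0
    · simp [hx]
    by_cases hy : y = 0
    · simp [hy]
    have hpt (z : F) : (if x ≠ 0 ∧ y ≠ 0 ∧ z ≠ 0 ∧ x + y + z ≠ 0 then (1 : ℤ) else 0) =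
        1 - (if z = 0 then 1 else 0) - (if z = x + y then 1 else 0) +
          (if z = 0 then (if x = y then 1 else 0) else 0) := by
      have h1 : x + y + z = 0 ↔ z = x + y := by rw [CharTwo.add_eq_zero, eq_comm]
      have h2 : (0 : F) = x + y ↔ x = y := by rw [eq_comm, CharTwo.add_eq_zero]
      simp only [ne_eq, h1, hx, hy]
      by_cases hz0 : z = 0
      · subst hz0
        by_cases hxy : x = y <;> simp [h2, hxy, CharTwo.add_self_eq_zero]
      · by_cases hzx : z = x + y <;> simp [hz0, hzx]
        grind
    simp only [hpt, Finset.sum_add_distrib, Finset.sum_sub_distrib, Finset.sum_ite_eq',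
      Finset.mem_univ, if_true, hx, hy, if_false]
    simp
    ring
  have hy (x : F) : (∑ y : F, if x = 0 then 0 else if y = 0 then 0 else
        ((Fintype.card F : ℤ) - 2 + if x = y then 1 else 0)) =
      if x = 0 then 0 else ((Fintype.card F : ℤ) - 1) * (Fintype.card F - 2) + 1 := by
    by_cases hx : x = 0
    · simp [hx]
    have hpt (y : F) : (if y = 0 then 0 else
        ((Fintype.card F : ℤ) - 2 + if x = y then 1 else 0)) =
        ((Fintype.card F : ℤ) - 2) - (if y = 0 then (Fintype.card F : ℤ) - 2 else 0) +
          if x = y then 1 else 0 := by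
      by_cases hy0 : y = 0 <;> simp [hy0, hx]
    simp only [hx, if_false, hpt, Finset.sum_add_distrib, Finset.sum_sub_distrib,
      Finset.sum_ite_eq', Finset.sum_ite_eq, Finset.mem_univ, if_true]
    simp
    ring
  have hpt (x : F) :
      (if x = 0 then 0 else ((Fintype.card F : ℤ) - 1) * (Fintype.card F - 2) + 1) =
      (((Fintype.card F : ℤ) - 1) * (Fintype.card F - 2) + 1) -
        if x = 0 then ((Fintype.card F : ℤ) - 1) * (Fintype.card F - 2) + 1 else 0 := by
    split_ifs <;> simp
  simp only [hz, hy]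
  simp only [hpt, Finset.sum_sub_distrib, Finset.sum_ite_eq', Finset.mem_univ, if_true]
  simp
  ring

open Classical in
lemma card_exactlyOneZero_sum_ne_zero :
    (Nat.card {t : F × F × F × F // ExactlyOneZero t.1 t.2.1 t.2.2.1 t.2.2.2 ∧
        t.1 + t.2.1 + t.2.2.1 + t.2.2.2 ≠ 0} : ℤ) =
      4 * ((Fintype.card F - 1) * (Fintype.card F ^ 2 - 3 * Fintype.card F + 3)) := by
  let f (x y z : F) : ℤ := if x ≠ 0 ∧ y ≠ 0 ∧ z ≠ 0 ∧ x + y + z ≠ 0 then 1 else 0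
  have hpt (a b c d : F) :
      (if ExactlyOneZero a b c d ∧ a + b + c + d ≠ 0 then (1 : ℤ) else 0) =
      (if a = 0 then f b c d else 0) + (if b = 0 then f a c d else 0) +
        (if c = 0 then f a b d else 0) + (if d = 0 then f a b c else 0) := by
    by_cases ha : a = 0 <;> by_cases hb : b = 0 <;> by_cases hc : c = 0 <;>
      by_cases hd : d = 0 <;> simp [ExactlyOneZero, f, ha, hb, hc, hd]
  rw [Nat.card_eq_fintype_card, Fintype.card_subtype, Finset.card_filter]
  push_cast
  simp only [Fintype.sum_prod_type, hpt, Finset.sum_add_distrib, Finset.sum_ite_eq',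
    Finset.mem_univ, if_true, Finset.sum_ite_irrel, Finset.sum_const_zero]
  rw [show ∑ x, ∑ y, ∑ z, f x y z = _ from sum_indicator_nonzero_sum_ne_zero]
  ring

end Counting

/-- The number of tuples `(a₁,a₂,a₃,a₄) ∈ 𝔽_{2^r}^4` with exactly one `aᵢ = 0`
whose `4 × 4` Hadamard matrix is NMDS equals `4(2^r-1)(2^{2r} - 3·2^r + 3)`. -/
theorem count_hadamard_nmds_one_zero (r : ℕ) (hr : 1 ≤ r) :
    (Nat.card {t : GaloisField 2 r × GaloisField 2 r × GaloisField 2 r × GaloisField 2 r //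
        ExactlyOneZero t.1 t.2.1 t.2.2.1 t.2.2.2 ∧
        IsNMDS (Had t.1 t.2.1 t.2.2.1 t.2.2.2)} : ℤ) =
      4 * (2 ^ r - 1) * (2 ^ (2 * r) - 3 * 2 ^ r + 3) := by
  classical
  have : Fintype (GaloisField 2 r) := Fintype.ofFinite _
  have hcard : Fintype.card (GaloisField 2 r) = 2 ^ r := by
    rw [← Nat.card_eq_fintype_card, GaloisField.card 2 r (by omega)]
  rw [Nat.card_congr (Equiv.subtypeEquivRight fun _ ↦
    and_congr_right fun h ↦ h.isNMDS_Had_iff), card_exactlyOneZero_sum_ne_zero, hcard]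
  push_cast
  ring
end

section
/- Let r ≥ 1, 𝔽 = 𝔽_{2^r}, and let a1, a2, a3, a4 ∈ 𝔽 be such that exactly one of a1, a2, a3, a4 equals 0. Then the 4×4 circulant matrix Circ(a1, a2, a3, a4) is an NMDS matrix over 𝔽. -/
open Matrix

/-- The `4 × 4` circulant matrix with first row `a, b, c, d`. -/
def Circ {F : Type*} (a b c d : F) : Matrix (Fin 4) (Fin 4) F :=
  !![a, b, c, d; d, a, b, c; c, d, a, b; b, c, d, a]

/-- An injection `Fin n → Fin (n + 1)` omits some `i`, hence is `i.succAbove` up to reordering. -/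
theorem exists_eq_succAbove_comp_perm {n : ℕ} {f : Fin n → Fin (n + 1)}
    (hf : Function.Injective f) :
    ∃ (i : Fin (n + 1)) (e : Equiv.Perm (Fin n)), f = i.succAbove ∘ e := by
  obtain ⟨i, hi⟩ : ∃ i, ∀ k, f k ≠ i := by
    by_contra! h
    simpa using Fintype.card_le_of_surjective f h
  choose e he using fun k => Fin.exists_succAbove_eq (hi k)
  have hinj : Function.Injective e := fun x y hxy => hf (by rw [← he x, ← he y, hxy])
  exact ⟨i, Equiv.ofBijective e (Finite.injective_iff_bijective.mp hinj),
    funext fun k => (he k).symm⟩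

theorem circ_transpose {F : Type*} (a b c d : F) : (Circ a b c d)ᵀ = Circ a d c b := by
  ext i j
  fin_cases i <;> fin_cases j <;> rfl

theorem ExactlyOneZero.reverse {F : Type*} [Zero F] {a b c d : F}
    (h : ExactlyOneZero a b c d) : ExactlyOneZero a d c b := by
  unfold ExactlyOneZero at *
  tauto

theorem circ_apply {F : Type*} (a b c d : F) (i j : Fin 4) :
    Circ a b c d i j = ![a, b, c, d] (j - i) := by
  fin_cases i <;> fin_cases j <;> rfl

/-- The zeros of the circulant matrix form exactly one cyclic diagonal. -/
theorem ExactlyOneZero.exists_circ_eq_zero_iff {F : Type*} [Zero F] {a b c d : F}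
    (h : ExactlyOneZero a b c d) :
    ∃ k : Fin 4, ∀ i j, Circ a b c d i j = 0 ↔ j = i + k := by
  have hk : ∃ k : Fin 4, ∀ l, ![a, b, c, d] l = 0 ↔ l = k := by
    rcases h with h | h | h | h
    · exact ⟨0, fun l => by fin_cases l <;> simp [h]⟩
    · exact ⟨1, fun l => by fin_cases l <;> simp [h]⟩
    · exact ⟨2, fun l => by fin_cases l <;> simp [h]⟩
    · exact ⟨3, fun l => by fin_cases l <;> simp [h]⟩
  obtain ⟨k, hk⟩ := hk
  exact ⟨k, fun i j => by rw [circ_apply, hk, sub_eq_iff_eq_add']⟩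

/-- In characteristic two, the adjugate of a `4 × 4` circulant matrix is its cube. -/
theorem adjugate_circ {F : Type*} [Field F] [CharP F 2] (a b c d : F) :
    (Circ a b c d).adjugate =
      Circ ((a + c) ^ 2 * a + (b + d) ^ 2 * c) ((a + c) ^ 2 * b + (b + d) ^ 2 * d)
        ((a + c) ^ 2 * c + (b + d) ^ 2 * a) ((a + c) ^ 2 * d + (b + d) ^ 2 * b) := by
  have h2 : (2 : F) = 0 := CharTwo.two_eq_zero
  ext i j
  rw [adjugate_fin_succ_eq_det_submatrix, det_fin_three]
  fin_cases i <;> fin_cases j <;> simp [Circ, Fin.succAbove] <;> grind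

theorem ExactlyOneZero.exists_adjugate_circ_ne_zero {F : Type*} [Field F] [CharP F 2]
    {a b c d : F} (h : ExactlyOneZero a b c d) (i : Fin 4) :
    ∃ j, (Circ a b c d).adjugate j i ≠ 0 := by
  have h2 : (2 : F) = 0 := CharTwo.two_eq_zero
  by_contra! hz
  rw [adjugate_circ] at hz
  have hall : ∀ l, ![(a + c) ^ 2 * a + (b + d) ^ 2 * c, (a + c) ^ 2 * b + (b + d) ^ 2 * d,
      (a + c) ^ 2 * c + (b + d) ^ 2 * a, (a + c) ^ 2 * d + (b + d) ^ 2 * b] l = 0 := fun l => by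
    simpa [circ_apply] using hz (i - l)
  have h0 : (a + c) ^ 2 * a + (b + d) ^ 2 * c = 0 := hall 0
  have h1 : (a + c) ^ 2 * b + (b + d) ^ 2 * d = 0 := hall 1
  have h2' : (a + c) ^ 2 * c + (b + d) ^ 2 * a = 0 := hall 2
  have h3 : (a + c) ^ 2 * d + (b + d) ^ 2 * b = 0 := hall 3
  have hsum : a + b + c + d = 0 := by
    have : (a + b + c + d) ^ 3 = 0 := by
      linear_combination h0 + h1 + h2' + h3 +
        (a + b + c + d) * (a + c) * (b + d) * h2
    exact pow_eq_zero_iff (by norm_num) |>.mp this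
  have hu : b + d = a + c := by linear_combination hsum - (a + c) * h2
  have ht : a + c = 0 := by
    have : (a + c) ^ 3 = 0 := by
      rw [hu] at h0
      linear_combination h0
    exact pow_eq_zero_iff (by norm_num) |>.mp this
  rw [ht] at hu
  rcases h with ⟨h, h'⟩ | ⟨-, h, h'⟩ | ⟨h', -, h, -⟩ | ⟨-, h', -, h⟩ <;> simp_all

theorem ExactlyOneZero.exists_det_submatrix_circ_ne_zero {F : Type*} [Field F] [CharP F 2]
    {a b c d : F} (h : ExactlyOneZero a b c d) {g : ℕ} (hg : 1 ≤ g) (hg' : g ≤ 3)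
    {row : Fin g → Fin 4} {col : Fin (g + 1) → Fin 4}
    (hrow : Function.Injective row) (hcol : Function.Injective col) :
    ∃ s : Fin g → Fin (g + 1), Function.Injective s ∧
      ((Circ a b c d).submatrix row (col ∘ s)).det ≠ 0 := by
  obtain ⟨k, hk⟩ := h.exists_circ_eq_zero_iff
  obtain rfl | rfl | rfl : g = 1 ∨ g = 2 ∨ g = 3 := by omega
  · obtain ⟨p, hp⟩ : ∃ p, col p ≠ row 0 + k := by
      by_contra! hp
      exact absurd (hcol ((hp 0).trans (hp 1).symm)) (by decide)
    exact ⟨fun _ => p, Function.injective_of_subsingleton _, by simpa [hk] using hp⟩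
  · have hne : row 0 ≠ row 1 := hrow.ne (by decide)
    obtain ⟨p, hp⟩ : ∃ p, col p = row 0 + k ∨ col p = row 1 + k := by
      obtain ⟨j, e, rfl⟩ := exists_eq_succAbove_comp_perm hcol
      have hz : ∀ z, z ≠ j → ∃ p, (j.succAbove ∘ e) p = z := fun z hz => by
        obtain ⟨q, hq⟩ := Fin.exists_succAbove_eq hz
        exact ⟨e.symm q, by simpa using hq⟩
      by_cases h0 : row 0 + k = j
      · obtain ⟨p, hp⟩ := hz (row 1 + k) fun h1 => hne (add_right_cancel (h0.trans h1.symm))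
        exact ⟨p, Or.inr hp⟩
      · obtain ⟨p, hp⟩ := hz _ h0
        exact ⟨p, Or.inl hp⟩
    obtain ⟨q, hq⟩ := exists_ne p
    have hqp : col q ≠ col p := hcol.ne hq
    refine ⟨![p, q], by simp [Function.Injective, Fin.forall_fin_two, hq, hq.symm], ?_⟩
    rw [det_fin_two]
    simp only [submatrix_apply, Function.comp_apply, cons_val_zero, cons_val_one]
    rcases hp with hp | hp
    · rw [(hk (row 0) (col p)).mpr hp, zero_mul, zero_sub, neg_ne_zero]
      refine mul_ne_zero ?_ ?_ <;> rw [Ne, hk]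
      · rwa [← hp]
      · rw [hp]; exact fun h => hne (add_right_cancel h)
    · rw [(hk (row 1) (col p)).mpr hp, mul_zero, sub_zero]
      refine mul_ne_zero ?_ ?_ <;> rw [Ne, hk]
      · rw [hp]; exact fun h => hne (add_right_cancel h).symm
      · rwa [← hp]
  · obtain ⟨i, e, rfl⟩ := exists_eq_succAbove_comp_perm hrow
    obtain ⟨j, hj⟩ := h.exists_adjugate_circ_ne_zero i
    rw [adjugate_fin_succ_eq_det_submatrix] at hj
    let σ := Equiv.ofBijective col (Finite.injective_iff_bijective.mp hcol)
    refine ⟨σ.symm ∘ j.succAbove, σ.symm.injective.comp Fin.succAbove_right_injective, ?_⟩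
    have hσ : col ∘ σ.symm ∘ j.succAbove = j.succAbove :=
      funext fun x => σ.apply_symm_apply (j.succAbove x)
    rw [hσ]
    change (((Circ a b c d).submatrix i.succAbove j.succAbove).submatrix e id).det ≠ 0
    rw [det_permute]
    exact mul_ne_zero ((Int.isUnit_iff.mp (Equiv.Perm.sign e).isUnit).elim
      (fun h => by simp [h]) (fun h => by simp [h])) (right_ne_zero_of_mul hj)

/-- If exactly one of `a₁, a₂, a₃, a₄ ∈ 𝔽_{2^r}` is zero, then the `4 × 4`
circulant matrix `Circ(a₁, a₂, a₃, a₄)` is NMDS. -/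
theorem circulant_one_zero_nmds (r : ℕ) (hr : 1 ≤ r)
    (a1 a2 a3 a4 : GaloisField 2 r)
    (hzero : ExactlyOneZero a1 a2 a3 a4) :
    IsNMDS (Circ a1 a2 a3 a4) := by
  obtain ⟨k, hk⟩ := hzero.exists_circ_eq_zero_iff
  refine ⟨fun h => ?_, fun g hg hg' => ?_⟩
  · refine h 1 (fun _ => 0) (fun _ => k) (Function.injective_of_subsingleton _)
      (Function.injective_of_subsingleton _) ?_
    simp [hk]
  · have hg3 : g ≤ 3 := by simpa using hg'
    refine ⟨fun row col hrow hcol =>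
      hzero.exists_det_submatrix_circ_ne_zero hg hg3 hrow hcol, fun row col hrow hcol => ?_⟩
    obtain ⟨s, hs, hdet⟩ :=
      hzero.reverse.exists_det_submatrix_circ_ne_zero hg hg3 hcol hrow
    refine ⟨s, hs, ?_⟩
    rwa [← circ_transpose, ← transpose_submatrix, det_transpose] at hdet
end
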